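/- The probability q_n that a simple symmetric random walk of length n on ℤ is admissible (non-negative and ending in its maximum) satisfies, as n → ∞, q_n = 1/n − 4/(3n²) + 88/(45n³) − 976/(315n⁴) + 3488/(675n⁵) − 276928/(31185n⁶) + O(n^{−7}). -/

import Mathlib

/-- Partial sum `S_k` of the `±1`-walk encoded by `ε : Fin n → Bool`
(`true` = step `+1`, `false` = step `-1`). -/
def walkSum (n : ℕ) (ε : Fin n → Bool) (k : ℕ) : ℤ :=
  ∑ i : Fin n, if (i : ℕ) < k then (if ε i then 1 else -1) else 0

/-- `W n h`: number of `±1`-paths of length `n` with `0 ≤ S_k ≤ h` for all `k` and `S_n = h`. -/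
noncomputable def W (n h : ℕ) : ℕ :=
  Nat.card {ε : Fin n → Bool //
    (∀ k ≤ n, 0 ≤ walkSum n ε k ∧ walkSum n ε k ≤ (h : ℤ)) ∧ walkSum n ε n = (h : ℤ)}

/-- The probability `q_n = Σ_{h≥0} W(n,h)/2^n` that a simple symmetric walk of length `n`
on `ℤ` is admissible. -/
noncomputable def qAdm (n : ℕ) : ℝ := (∑' h : ℕ, (W n h : ℝ)) / 2 ^ n

section Aux

open Real Set Filter Topology MeasureTheory


noncomputable def TT (n : ℕ) : ℝ := ∫ θ in (0:ℝ)..(π/2), cos θ ^ n * sin θ ^ 2 / θ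

theorem bInt_cont (n k : ℕ) : Continuous (fun θ : ℝ => cos θ ^ n * sin θ * (1 - cos θ) ^ k) := by
  fun_prop

theorem bInt_eq (k : ℕ) : ∀ n : ℕ, ∫ θ in (0:ℝ)..(π/2), cos θ ^ n * sin θ * (1 - cos θ) ^ k
    = (k.factorial : ℝ) / ∏ i ∈ Finset.range (k+1), ((n:ℝ) + 1 + i) := by
  induction k with
  | zero =>
    intro n
    have h : ∀ x ∈ uIcc (0:ℝ) (π/2), HasDerivAt (fun x : ℝ => -(cos x ^ (n+1)) / ((n:ℝ)+1))
        (cos x ^ n * sin x * (1 - cos x) ^ 0) x := by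
      intro x _
      have h1 := ((hasDerivAt_cos x).pow (n+1)).neg.div_const ((n:ℝ)+1)
      refine h1.congr_deriv ?_
      have : (n:ℝ) + 1 ≠ 0 := by positivity
      simp [field]
    rw [intervalIntegral.integral_eq_sub_of_hasDerivAt h ((bInt_cont n 0).intervalIntegrable _ _)]
    simp
    field_simp
  | succ k ih =>
    intro n
    have h : ∀ θ : ℝ, cos θ ^ n * sin θ * (1 - cos θ) ^ (k+1) =
       cos θ ^ n * sin θ * (1 - cos θ) ^ k - cos θ ^ (n+1) * sin θ * (1 - cos θ) ^ k := by
      intro θ; ring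
    simp_rw [h]
    rw [intervalIntegral.integral_sub ((bInt_cont n k).intervalIntegrable _ _)
      ((bInt_cont (n+1) k).intervalIntegrable _ _), ih, ih]
    rw [Finset.prod_range_succ _ (k+1), Finset.prod_range_succ']
    rw [Finset.prod_range_succ _ k]
    have e : ∀ i ∈ Finset.range k, ((n:ℝ) + 1 + (i+1 : ℕ)) = ((n+1:ℕ):ℝ) + 1 + i := by
      intro i _; push_cast; ring
    rw [Finset.prod_congr rfl e]
    have hp : 0 < ∏ i ∈ Finset.range k, (((n+1:ℕ):ℝ) + 1 + i) :=
      Finset.prod_pos (fun i _ => by positivity)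
    set A := ∏ i ∈ Finset.range k, (((n+1:ℕ):ℝ) + 1 + i)
    rw [Nat.factorial_succ]
    push_cast
    field_simp
    ring

noncomputable def qpoly (t : ℝ) : ℝ := (-164669/50295168000) * t^0
  + (1367/1371686400) * t^1
  + (-610483/4023613440000) * t^2
  + (23211137/1520925880320000) * t^3
  + (-1137771137/1003811081011200000) * t^4
  + (397441643/6022866486067200000) * t^5
  + (-351443641/112426841073254400000) * t^6
  + (750306913/6071049417955737600000) * t^7
  + (-7563682681/1821314825386721280000000) * t^8
  + (481658893/4006892615850786816000000) * t^9
  + (-305663548781/100973693919439827763200000000) * t^10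
  + (8094130453/121168432703327793315840000000) * t^11
  + (-15728622131/12116843270332779331584000000000) * t^12
  + (107970647/4846737308133111732633600000000) * t^13
  + (-681103944487/2015273372721747858429050880000000000) * t^14
  + (54758420309/12091640236330487150574305280000000000) * t^15
  + (-2584257217/48366560945321948602297221120000000000) * t^16
  + (2669833/4836656094532194860229722112000000000) * t^17
  + (-12928079/2611794291047385224524049940480000000000) * t^18
  + (81920029/2154730290114092810232341200896000000000000) * t^19
  + (-2535583/10342705392547645489115237764300800000000000) * t^20
  + (159641/124112464710571745869382853171609600000000000) * t^21
  + (-15517/2978699153053721900865188476118630400000000000) * t^22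
  + (263/17872194918322331405191130856711782400000000000) * t^23
  + (-263/11795648646092738727426146365429776384000000000000) * t^24

noncomputable def rpoly (x y : ℝ) : ℝ := -1/3 - 1/45 * (x + y) - 1/189 * (x^2+x*y+y^2)
      - 23/14175 * (x^3+x^2*y+x*y^2+y^3) - 263/467775 * (x^4+x^3*y+x^2*y^2+x*y^3+y^4)

theorem qpoly_cont : Continuous qpoly := by unfold qpoly; fun_prop

theorem poly_id (θ : ℝ) : ∀ x, x = θ^2/2 - θ^4/24 + θ^6/720 - θ^8/40320 + θ^10/3628800 - θ^12/479001600 →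
    (θ - θ^3/6 + θ^5/120 - θ^7/5040 + θ^9/362880 - θ^11/39916800) 
       = θ * (1 - 1/3 * x - 1/45 * x^2 - 1/189 * x^3 - 23/14175 * x^4 - 263/467775 * x^5)
         + θ^13 * qpoly (θ^2) := by
  intro x hx
  rw [hx]; unfold qpoly; ring

theorem sinc_taylor : ∃ C : ℝ, 0 ≤ C ∧ ∀ θ : ℝ, 0 ≤ θ → θ ≤ π/2 →
    |sin θ - θ * (1 - 1/3 * (1 - cos θ) - 1/45 * (1 - cos θ)^2 - 1/189 * (1 - cos θ)^3
      - 23/14175 * (1 - cos θ)^4 - 263/467775 * (1 - cos θ)^5)| ≤ C * (θ * (1 - cos θ)^6) := by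
  obtain ⟨C1, hC1⟩ := (isCompact_Icc (a := (0:ℝ)) (b := π/2)).exists_bound_of_continuousOn
    (f := fun θ : ℝ => qpoly (θ^2)) (by have := qpoly_cont; fun_prop)
  let X : ℝ → ℝ := fun θ => θ^2/2 - θ^4/24 + θ^6/720 - θ^8/40320 + θ^10/3628800 - θ^12/479001600
  obtain ⟨C2, hC2⟩ := (isCompact_Icc (a := (0:ℝ)) (b := π/2)).exists_bound_of_continuousOn
    (f := fun θ : ℝ => rpoly (1 - cos θ) (X θ)) (by unfold rpoly; fun_prop)
  have hC1' : 0 ≤ C1 := (norm_nonneg _).trans (hC1 0 ⟨le_rfl, by positivity⟩)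
  have hC2' : 0 ≤ C2 := (norm_nonneg _).trans (hC2 0 ⟨le_rfl, by positivity⟩)
  refine ⟨(1 + C1 + 2 * C2) * 5^6, by positivity, ?_⟩
  intro θ h0 h1
  have hpi : θ ≤ 2 := by linarith [pi_le_four]
  have hb := Complex.exp_bound' (x := θ * Complex.I) (n := 13) (by
    simp [abs_of_nonneg h0]; linarith)
  have hn : ‖(θ * Complex.I)‖ = θ := by simp [abs_of_nonneg h0]
  rw [hn] at hb
  have hre := (Complex.abs_re_le_norm _).trans hb
  have him := (Complex.abs_im_le_norm _).trans hb
  have hI : ∀ m, (θ * Complex.I)^m = (θ:ℂ)^m * Complex.I^m := fun m => mul_pow _ _ _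
  have i2 : Complex.I^2 = -1 := Complex.I_sq
  have i3 : Complex.I^3 = -Complex.I := Complex.I_pow_three
  have i4 : Complex.I^4 = 1 := Complex.I_pow_four
  have i5 : Complex.I^5 = Complex.I := by rw [pow_succ, i4, one_mul]
  have i6 : Complex.I^6 = -1 := by rw [show 6 = 4+2 from rfl, pow_add, i4, i2, one_mul]
  have i7 : Complex.I^7 = -Complex.I := by rw [show 7 = 4+3 from rfl, pow_add, i4, i3, one_mul]
  have i8 : Complex.I^8 = 1 := by rw [show 8 = 4+4 from rfl, pow_add, i4, one_mul]
  have i9 : Complex.I^9 = Complex.I := by rw [pow_succ, i8, one_mul]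
  have i10 : Complex.I^10 = -1 := by rw [show 10 = 8+2 from rfl, pow_add, i8, i2, one_mul]
  have i11 : Complex.I^11 = -Complex.I := by rw [show 11 = 8+3 from rfl, pow_add, i8, i3, one_mul]
  have i12 : Complex.I^12 = 1 := by rw [show 12 = 8+4 from rfl, pow_add, i8, i4, one_mul]
  have hexp : Complex.exp (θ * Complex.I) - ∑ m ∈ Finset.range 13, (θ * Complex.I)^m / m.factorial
     = ((cos θ - (1 - X θ) : ℝ) : ℂ) + ((sin θ - (θ - θ^3/6 + θ^5/120 - θ^7/5040 + θ^9/362880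
        - θ^11/39916800) : ℝ) : ℂ) * Complex.I := by
    rw [Complex.exp_mul_I]
    simp only [Finset.sum_range_succ, Finset.sum_range_zero, hI, i2, i3, i4, i5, i6, i7, i8, i9, i10,
      i11, i12, Nat.factorial, X]
    push_cast
    ring
  rw [hexp] at hre him
  simp only [Complex.add_re, Complex.ofReal_re, Complex.mul_re, Complex.ofReal_im, Complex.I_re,
    Complex.I_im, Complex.add_im, Complex.mul_im, mul_zero, mul_one, zero_mul, sub_zero, add_zero, zero_add] at hre him
  have hf : θ^13 / (Nat.factorial 13 : ℝ) * 2 ≤ θ^13 := by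
    have : (2:ℝ) ≤ (Nat.factorial 13 : ℝ) := by norm_num [Nat.factorial]
    have h13 : 0 ≤ θ^13 := by positivity
    rw [div_mul_eq_mul_div, div_le_iff₀ (by positivity)]
    nlinarith
  have hre' := hre.trans hf
  have him' := him.trans hf
  have k1 := hC1 θ ⟨h0, h1⟩
  have k2 := hC2 θ ⟨h0, h1⟩
  have hcos : θ^2 ≤ 5 * (1 - cos θ) := by
    have := Real.cos_le_one_sub_mul_cos_sq (x := θ) (by rw [abs_of_nonneg h0]; linarith [pi_pos])
    have hp2 : π^2 ≤ 10 := by nlinarith [pi_lt_d2, pi_pos]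
    have h2 : 2 / π^2 * θ^2 ≤ 1 - cos θ := by linarith
    have h3 : θ^2 / 5 ≤ 2 / π^2 * θ^2 := by
      rw [div_mul_eq_mul_div, div_le_div_iff₀ (by norm_num) (by positivity)]
      nlinarith [sq_nonneg θ]
    linarith
  have h12 : θ^12 ≤ 5^6 * (1 - cos θ)^6 := by
    have := pow_le_pow_left₀ (by positivity) hcos 6
    rw [mul_pow] at this
    calc θ^12 = (θ^2)^6 := by ring
      _ ≤ _ := this
  set c := cos θ
  set s := sin θ
  set x := X θ with hx
  have key : s - θ * (1 - 1/3 * (1 - c) - 1/45 * (1 - c)^2 - 1/189 * (1 - c)^3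
      - 23/14175 * (1 - c)^4 - 263/467775 * (1 - c)^5)
     = (s - (θ - θ^3/6 + θ^5/120 - θ^7/5040 + θ^9/362880 - θ^11/39916800))
      + θ^13 * qpoly (θ^2)
      + θ * (c - (1 - x)) * (rpoly
       (1 - c) x) := by
    have e1 := poly_id θ x (by simp only [hx, X])
    rw [e1]; unfold rpoly; ring
  rw [key]
  rw [Real.norm_eq_abs] at k1 k2
  refine (abs_add_three _ _ _).trans ?_
  rw [abs_mul, abs_mul (θ * _), abs_mul θ, abs_of_nonneg h0, abs_of_nonneg (pow_nonneg h0 13)]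
  have m1 := mul_le_mul_of_nonneg_left k1 (pow_nonneg h0 13)
  have m2 : θ * |c - (1-x)| * |rpoly
       (1 - c) x| ≤ 2 * θ^13 * C2 := by
    refine mul_le_mul ?_ k2 (abs_nonneg _) (by positivity)
    exact mul_le_mul hpi hre' (abs_nonneg _) (by norm_num)
  calc _ ≤ θ^13 + θ^13 * C1 + 2 * θ^13 * C2 := by linarith
    _ = (1 + C1 + 2 * C2) * (θ * θ^12) := by ring
    _ ≤ (1 + C1 + 2 * C2) * (θ * (5^6 * (1 - c)^6)) := by gcongr
    _ = _ := by ring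

theorem TT_asymp : ∃ C : ℝ, 0 ≤ C ∧ ∀ n : ℕ, 1 ≤ n → |TT n -
          (1 / (n : ℝ) - 4 / (3 * (n : ℝ) ^ 2) + 88 / (45 * (n : ℝ) ^ 3) -
            976 / (315 * (n : ℝ) ^ 4) + 3488 / (675 * (n : ℝ) ^ 5) -
            276928 / (31185 * (n : ℝ) ^ 6))| ≤ C / (n:ℝ)^7 := by
  obtain ⟨C, hC, hT⟩ := sinc_taylor
  refine ⟨720 * C + 30000, by positivity, ?_⟩
  intro n hn
  have hc : Continuous (fun θ : ℝ => cos θ ^ n * sin θ ^ 2 / θ) := by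
    have : (fun θ : ℝ => cos θ ^ n * sin θ ^ 2 / θ) = fun θ => cos θ ^ n * sin θ * sinc θ := by
      funext θ
      by_cases h : θ = 0
      · simp [h]
      · rw [sinc_of_ne_zero h]; ring
    rw [this]
    have := continuous_sinc
    fun_prop
  let a : Fin 6 → ℝ := ![1, -1/3, -1/45, -1/189, -23/14175, -263/467775]
  have h1 : ‖∫ θ in (0:ℝ)..(π/2), (cos θ ^ n * sin θ ^ 2 / θ -
      ∑ k : Fin 6, a k * (cos θ ^ n * sin θ * (1 - cos θ) ^ (k:ℕ)))‖ ≤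
      ∫ θ in (0:ℝ)..(π/2), C * (cos θ ^ n * sin θ * (1 - cos θ) ^ 6) := by
    refine intervalIntegral.norm_integral_le_of_norm_le (by positivity) ?_ ?_
    · refine Eventually.of_forall fun θ hθ => ?_
      have hθ0 := hθ.1
      have := hT θ hθ.1.le hθ.2
      have hcs : 0 ≤ cos θ := cos_nonneg_of_mem_Icc ⟨by linarith [pi_pos], hθ.2⟩
      have hsn : 0 ≤ sin θ := sin_nonneg_of_nonneg_of_le_pi hθ.1.le (by linarith [hθ.2, pi_pos])
      have e : cos θ ^ n * sin θ ^ 2 / θ - ∑ k : Fin 6, a k * (cos θ ^ n * sin θ * (1 - cos θ) ^ (k:ℕ))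
        = (cos θ ^ n * sin θ / θ) * (sin θ - θ * (1 - 1/3 * (1 - cos θ) - 1/45 * (1 - cos θ)^2
          - 1/189 * (1 - cos θ)^3 - 23/14175 * (1 - cos θ)^4 - 263/467775 * (1 - cos θ)^5)) := by
        simp only [Fin.sum_univ_succ, a]
        simp
        field_simp
        ring
      rw [e, norm_mul, Real.norm_eq_abs, Real.norm_eq_abs, abs_of_nonneg (by positivity)]
      calc _ ≤ cos θ ^ n * sin θ / θ * (C * (θ * (1 - cos θ)^6)) := by gcongr
        _ = _ := by field_simp
    · exact Continuous.intervalIntegrable (by fun_prop) _ _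
  rw [intervalIntegral.integral_sub (hc.intervalIntegrable _ _)
    (Continuous.intervalIntegrable (by fun_prop) _ _), intervalIntegral.integral_finsetSum
    (fun i _ => Continuous.intervalIntegrable (by fun_prop) _ _)] at h1
  simp only [intervalIntegral.integral_const_mul, bInt_eq] at h1
  rw [Real.norm_eq_abs] at h1
  have hn' : (1:ℝ) ≤ n := by exact_mod_cast hn
  change |TT n - _| ≤ _ at h1
  have h2 : C * ((Nat.factorial 6 : ℝ) / ∏ i ∈ Finset.range (6+1), ((n:ℝ) + 1 + i)) ≤ 720 * C / (n:ℝ)^7 := by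
    have : (n:ℝ)^7 ≤ ∏ i ∈ Finset.range (6+1), ((n:ℝ) + 1 + i) := by
      have : (n:ℝ)^7 = ∏ i ∈ Finset.range (6+1), (n:ℝ) := by simp
      rw [this]
      refine Finset.prod_le_prod (fun _ _ => by positivity) (fun i _ => ?_)
      have : (0:ℝ) ≤ i := by positivity
      linarith
    have h6 : (Nat.factorial 6 : ℝ) = 720 := by norm_num [Nat.factorial]
    rw [h6, mul_comm 720 C, mul_div_assoc]
    gcongr
  have h3 : |(∑ k : Fin 6, a k * ((Nat.factorial (k:ℕ) : ℝ) / ∏ i ∈ Finset.range ((k:ℕ)+1), ((n:ℝ) + 1 + i))) -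
     (1 / (n : ℝ) - 4 / (3 * (n : ℝ) ^ 2) + 88 / (45 * (n : ℝ) ^ 3) -
            976 / (315 * (n : ℝ) ^ 4) + 3488 / (675 * (n : ℝ) ^ 5) -
            276928 / (31185 * (n : ℝ) ^ 6))| ≤ 30000 / (n:ℝ)^7 := by
    generalize (n:ℝ) = n at *
    have e : (∑ k : Fin 6, a k * ((Nat.factorial (k:ℕ) : ℝ) / ∏ i ∈ Finset.range ((k:ℕ)+1), ((n:ℝ) + 1 + i))) -
     (1 / (n : ℝ) - 4 / (3 * (n : ℝ) ^ 2) + 88 / (45 * (n : ℝ) ^ 3) -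
            976 / (315 * (n : ℝ) ^ 4) + 3488 / (675 * (n : ℝ) ^ 5) -
            276928 / (31185 * (n : ℝ) ^ 6)) = ((4430848/693) * n^0 + (1182464/99) * n^1 + (1175197568/155925) * n^2 + (5426816/2475) * n^3 + (1328512/4455) * n^4 + (23312/1485) * n^5) /
        (n^6 * ((n+1)*(n+2)*(n+3)*(n+4)*(n+5)*(n+6))) := by
      simp only [Fin.sum_univ_succ, a, Finset.prod_range_succ, Nat.factorial]
      simp [Finset.prod_range_succ, Nat.factorial]
      have e2 : n + 1 + 1 = n + 2 := by ring
      have e3 : n + 1 + 2 = n + 3 := by ring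
      have e4 : n + 1 + 3 = n + 4 := by ring
      have e5 : n + 1 + 4 = n + 5 := by ring
      have e6 : n + 1 + 5 = n + 6 := by ring
      simp only [e2, e3, e4, e5, e6]
      have := hn'
      field_simp
      ring
    rw [e, abs_div, div_le_div_iff₀ (by positivity) (by positivity), abs_of_nonneg (a := n^6 * _) (by positivity)]
    have hN : |(4430848/693) * n^0 + (1182464/99) * n^1 + (1175197568/155925) * n^2 + (5426816/2475) * n^3 + (1328512/4455) * n^4 + (23312/1485) * n^5| ≤ 30000 * n^5 := by
      have p1 : n^4 ≤ n^5 := pow_le_pow_right₀ hn' (by norm_num)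
      have p2 : n^3 ≤ n^5 := pow_le_pow_right₀ hn' (by norm_num)
      have p3 : n^2 ≤ n^5 := pow_le_pow_right₀ hn' (by norm_num)
      have p4 : n^1 ≤ n^5 := pow_le_pow_right₀ hn' (by norm_num)
      have p5 : n^0 ≤ n^5 := pow_le_pow_right₀ hn' (by norm_num)
      have q1 : 0 ≤ n^4 := by positivity
      have q2 : 0 ≤ n^3 := by positivity
      have q3 : 0 ≤ n^2 := by positivity
      have q4 : 0 ≤ n^1 := by positivity
      have q5 : 0 ≤ n^0 := by positivity
      have q0 : 0 ≤ n^5 := by positivity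
      rw [abs_le]
      constructor <;> linarith
    have hP : n^6 ≤ (n+1)*(n+2)*(n+3)*(n+4)*(n+5)*(n+6) := by
      calc n^6 = n*n*n*n*n*n := by ring
        _ ≤ _ := by gcongr <;> linarith
    calc _ ≤ 30000 * n^5 * n^7 := by gcongr
      _ = 30000 * (n^6 * n^6) := by ring
      _ ≤ _ := by gcongr
  have h4 := abs_sub_le (TT n) (∑ k : Fin 6, a k * ((Nat.factorial (k:ℕ) : ℝ) / ∏ i ∈ Finset.range ((k:ℕ)+1), ((n:ℝ) + 1 + i))) (1 / (n : ℝ) - 4 / (3 * (n : ℝ) ^ 2) + 88 / (45 * (n : ℝ) ^ 3) -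
            976 / (315 * (n : ℝ) ^ 4) + 3488 / (675 * (n : ℝ) ^ 5) -
            276928 / (31185 * (n : ℝ) ^ 6))
  refine h4.trans ?_
  rw [add_div]
  exact add_le_add (h1.trans h2) h3


noncomputable def kerF (a b m : ℕ) (θ : ℝ) : ℝ := θ ^ a * sin θ ^ b * cos θ ^ m / θ

noncomputable def osc (X θ : ℝ) : ℂ := Complex.exp (((-(X / θ) : ℝ) : ℂ) * Complex.I)

noncomputable def JJ (a b m : ℕ) (X : ℝ) : ℂ :=
  ∫ θ in (0:ℝ)..(π/2), ((kerF a b m θ : ℝ) : ℂ) * osc X θ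

theorem norm_osc (X θ : ℝ) : ‖osc X θ‖ = 1 := Complex.norm_exp_ofReal_mul_I _

theorem measurable_osc (X : ℝ) : Measurable (osc X) := by
  unfold osc; fun_prop

theorem ker_bound (a b m : ℕ) (h : 1 ≤ a + b) (θ : ℝ) (h0 : 0 < θ) (h1 : θ ≤ π/2) :
    |kerF a b m θ| ≤ θ ^ (a + b - 1) * cos θ ^ m := by
  have hc : 0 ≤ cos θ := cos_nonneg_of_mem_Icc ⟨by linarith [pi_pos], h1⟩
  have hs : 0 ≤ sin θ := sin_nonneg_of_nonneg_of_le_pi h0.le (by linarith [pi_pos])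
  have hs' : sin θ ≤ θ := sin_le h0.le
  unfold kerF
  rw [abs_of_nonneg (by positivity), div_le_iff₀ h0]
  calc θ ^ a * sin θ ^ b * cos θ ^ m ≤ θ ^ a * θ ^ b * cos θ ^ m := by gcongr
    _ = θ ^ (a+b-1+1) * cos θ ^ m := by rw [Nat.sub_add_cancel h, pow_add]
    _ = _ := by ring

theorem ker_norm_bound (a b m : ℕ) (h : 1 ≤ a + b) (X θ : ℝ) (h0 : 0 < θ) (h1 : θ ≤ π/2) :
    ‖((kerF a b m θ : ℝ) : ℂ) * osc X θ‖ ≤ θ ^ (a + b - 1) * cos θ ^ m := by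
  rw [norm_mul, norm_osc, mul_one, Complex.norm_real]
  exact ker_bound a b m h θ h0 h1

theorem ker_meas (a b m : ℕ) : Measurable (kerF a b m) := by unfold kerF; fun_prop

theorem ker_int (a b m : ℕ) (h : 1 ≤ a + b) (X : ℝ) :
    IntervalIntegrable (fun θ => ((kerF a b m θ : ℝ) : ℂ) * osc X θ) volume 0 (π/2) := by
  have hk : IntervalIntegrable (fun θ : ℝ => θ ^ (a + b - 1) * cos θ ^ m) volume 0 (π/2) :=
    Continuous.intervalIntegrable (by fun_prop) _ _
  refine hk.mono_fun' ?_ ?_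
  · have := measurable_osc X
    have := ker_meas a b m
    exact Measurable.aestronglyMeasurable (by fun_prop)
  · rw [uIoc_of_le (by positivity)]
    refine (ae_restrict_mem measurableSet_Ioc).mono fun θ hθ => ?_
    exact ker_norm_bound a b m h X θ hθ.1 hθ.2

theorem cos_le_exp5 (θ : ℝ) (h0 : 0 ≤ θ) (h1 : θ ≤ π/2) : cos θ ≤ exp (-(1/5) * θ^2) := by
  have := Real.cos_le_one_sub_mul_cos_sq (x := θ) (by rw [abs_of_nonneg h0]; linarith [pi_pos])
  have hp2 : π^2 ≤ 10 := by nlinarith [pi_lt_d2, pi_pos]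
  have h3 : θ^2 / 5 ≤ 2 / π^2 * θ^2 := by
    rw [div_mul_eq_mul_div, div_le_div_iff₀ (by norm_num) (by positivity)]
    nlinarith [sq_nonneg θ]
  have := add_one_le_exp (-(1/5) * θ^2)
  linarith

theorem base_bound (w : ℕ) (hw : 1 ≤ w) : ∃ C : ℝ, 0 ≤ C ∧ ∀ m : ℕ, 1 ≤ m →
    ∫ θ in (0:ℝ)..(π/2), θ ^ (w-1) * cos θ ^ m ≤ C / √m ^ w := by
  refine ⟨√5 ^ w * (1/2) * Gamma (w/2), ?_, ?_⟩
  · have : 0 < Gamma (w/2 : ℝ) := Gamma_pos_of_pos (by positivity)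
    positivity
  intro m hm
  have hm0 : (0:ℝ) < m := by exact_mod_cast hm
  have hq : (-1:ℝ) < ((w - 1 : ℕ) : ℝ) := by
    have : (0:ℝ) ≤ ((w - 1 : ℕ) : ℝ) := by positivity
    linarith
  have hI := integrableOn_rpow_mul_exp_neg_mul_rpow (p := 2) (b := m/5) hq (by norm_num) (by positivity)
  have hv := integral_rpow_mul_exp_neg_mul_rpow (p := 2) (b := m/5) (by norm_num) hq (by positivity)
  rw [intervalIntegral.integral_of_le (by positivity)]
  calc ∫ θ in Ioc (0:ℝ) (π/2), θ ^ (w-1) * cos θ ^ m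
      ≤ ∫ θ in Ioc (0:ℝ) (π/2), θ ^ ((w-1:ℕ):ℝ) * exp (-(m/5) * θ ^ (2:ℝ)) := by
        refine setIntegral_mono_on ?_ ?_ measurableSet_Ioc ?_
        · exact (Continuous.integrableOn_Icc (by fun_prop)).mono_set Ioc_subset_Icc_self
        · exact hI.mono_set Ioc_subset_Ioi_self
        · intro θ hθ
          rw [rpow_natCast, rpow_two]
          have hc : 0 ≤ cos θ := cos_nonneg_of_mem_Icc ⟨by linarith [pi_pos, hθ.1], hθ.2⟩
          have h0 := hθ.1.le
          gcongr
          calc cos θ ^ m ≤ exp (-(1/5) * θ^2) ^ m := by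
                gcongr; exact cos_le_exp5 θ hθ.1.le hθ.2
            _ = _ := by rw [← exp_nat_mul]; ring_nf
    _ ≤ ∫ θ in Ioi (0:ℝ), θ ^ ((w-1:ℕ):ℝ) * exp (-(m/5) * θ ^ (2:ℝ)) := by
        refine setIntegral_mono_set hI ?_ Ioc_subset_Ioi_self.eventuallyLE
        refine (ae_restrict_mem measurableSet_Ioi).mono fun θ hθ => ?_
        have : (0:ℝ) < θ := hθ
        simp only [Pi.zero_apply]
        positivity
    _ = _ := by
        rw [hv]
        have e : ((w-1:ℕ):ℝ) + 1 = w := by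
          rw [Nat.cast_sub hw]; push_cast; ring
        rw [e]
        have : ((m:ℝ)/5) ^ (-(w:ℝ)/2) = √5 ^ w / √m ^ w := by
          rw [neg_div, rpow_neg (by positivity), div_rpow (by positivity) (by positivity), inv_div,
            sqrt_eq_rpow, sqrt_eq_rpow, ← rpow_natCast, ← rpow_natCast, ← rpow_mul (by positivity),
            ← rpow_mul (by positivity)]
          ring_nf
        rw [this]; ring

theorem JJ_step (a b m : ℕ) (h : 1 ≤ a + b) (hm : 1 ≤ m) (X : ℝ) :
    (X * Complex.I) * JJ a b m X = -((a+1) * JJ (a+1) b m X) - b * JJ (a+2) (b-1) (m+1) X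
      + m * JJ (a+2) (b+1) (m-1) X := by
  have i0 := ker_int a b m h X
  have i1 := ker_int (a+1) b m (by omega) X
  have i2 := ker_int (a+2) (b-1) (m+1) (by omega) X
  have i3 := ker_int (a+2) (b+1) (m-1) (by omega) X
  let H : ℝ → ℝ := fun θ => θ^(a+1) * sin θ^b * cos θ^m
  have hd : ∀ θ ∈ Ioo (0:ℝ) (π/2), HasDerivAt (fun θ => ((H θ : ℝ) : ℂ) * osc X θ)
     ((X * Complex.I) * (((kerF a b m θ : ℝ) : ℂ) * osc X θ)
      + (a+1) * (((kerF (a+1) b m θ : ℝ) : ℂ) * osc X θ)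
      + b * (((kerF (a+2) (b-1) (m+1) θ : ℝ) : ℂ) * osc X θ)
      - m * (((kerF (a+2) (b+1) (m-1) θ : ℝ) : ℂ) * osc X θ)) θ := by
    intro θ hθ
    have h0 : θ ≠ 0 := hθ.1.ne'
    have hH : HasDerivAt H ((((a+1:ℕ):ℝ) * θ^a * sin θ^b + θ^(a+1) * (b * sin θ^(b-1) * cos θ)) * cos θ^m
       + θ^(a+1) * sin θ^b * (m * cos θ^(m-1) * (-sin θ))) θ := by
      have := (((hasDerivAt_pow (a+1) θ).mul ((hasDerivAt_sin θ).pow b)).mul ((hasDerivAt_cos θ).pow m))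
      exact this
    have hO : HasDerivAt (osc X) (osc X θ * (((X / θ^2 : ℝ) : ℂ) * Complex.I)) θ := by
      have h1 : HasDerivAt (fun θ : ℝ => -(X / θ)) (X / θ^2) θ := by
        have := ((hasDerivAt_inv h0).const_mul X).neg
        refine (this.congr_deriv ?_).congr_of_eventuallyEq ?_
        · field_simp
        · exact Eventually.of_forall fun y => by simp [div_eq_mul_inv]
      exact (h1.ofReal_comp.mul_const Complex.I).cexp
    refine (hH.ofReal_comp.mul hO).congr_deriv ?_
    have hC : (θ:ℂ) ≠ 0 := by exact_mod_cast h0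
    simp only [kerF, H]
    push_cast
    field_simp
    ring
  have hint : IntervalIntegrable (fun θ => (X * Complex.I) * (((kerF a b m θ : ℝ) : ℂ) * osc X θ)
      + (a+1) * (((kerF (a+1) b m θ : ℝ) : ℂ) * osc X θ)
      + b * (((kerF (a+2) (b-1) (m+1) θ : ℝ) : ℂ) * osc X θ)
      - m * (((kerF (a+2) (b+1) (m-1) θ : ℝ) : ℂ) * osc X θ)) volume 0 (π/2) :=
    (((i0.const_mul _).add (i1.const_mul _)).add (i2.const_mul _)).sub (i3.const_mul _)
  have hHc : Continuous H := by fun_prop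
  have hcont : ContinuousOn (fun θ => ((H θ : ℝ) : ℂ) * osc X θ) (Icc 0 (π/2)) := by
    intro θ hθ
    rcases eq_or_lt_of_le hθ.1 with h0 | h0
    · subst h0
      apply ContinuousAt.continuousWithinAt
      have hz : ((H 0 : ℝ) : ℂ) * osc X 0 = 0 := by simp [H]
      show Tendsto _ _ (𝓝 (((H 0 : ℝ) : ℂ) * osc X 0))
      rw [hz]
      apply squeeze_zero_norm (a := fun θ => ‖H θ‖)
      · intro t
        rw [norm_mul, norm_osc, mul_one, Complex.norm_real]
      · have := hHc.norm.tendsto 0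
        simpa [H] using this
    · apply ContinuousAt.continuousWithinAt
      have h0 : θ ≠ 0 := h0.ne'
      apply ContinuousAt.mul
      · exact (Complex.continuous_ofReal.comp hHc).continuousAt
      · unfold osc
        have : ContinuousAt (fun θ : ℝ => -(X/θ)) θ := by fun_prop (disch := exact h0)
        fun_prop
  have key := intervalIntegral.integral_eq_sub_of_hasDerivAt_of_le (by positivity) hcont hd hint
  have hm' : m ≠ 0 := by omega
  have z1 : H (π/2) = 0 := by simp [H, hm']
  have z0 : H 0 = 0 := by simp [H]
  rw [z1, z0, intervalIntegral.integral_sub (((i0.const_mul _).add (i1.const_mul _)).add (i2.const_mul _)) (i3.const_mul _),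
    intervalIntegral.integral_add ((i0.const_mul _).add (i1.const_mul _)) (i2.const_mul _),
    intervalIntegral.integral_add (i0.const_mul _) (i1.const_mul _)] at key
  simp only [intervalIntegral.integral_const_mul] at key
  rw [Complex.ofReal_zero, zero_mul, zero_mul, sub_zero] at key
  unfold JJ
  linear_combination key

theorem JJ_bound (r : ℕ) : ∀ a b : ℕ, 1 ≤ a + b → ∃ C : ℝ, 0 ≤ C ∧ ∀ m : ℕ, r + 1 ≤ m → ∀ X : ℝ, X ≠ 0 →
    ‖JJ a b m X‖ ≤ C / (|X|^r * √m ^ (a+b+r)) := by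
  induction r with
  | zero =>
    intro a b h
    obtain ⟨C, hC, hb⟩ := base_bound (a+b) h
    refine ⟨C, hC, fun m hm X hX => ?_⟩
    have := hb m hm
    simp only [pow_zero, one_mul, add_zero]
    refine le_trans ?_ this
    refine intervalIntegral.norm_integral_le_of_norm_le (by positivity) ?_ (Continuous.intervalIntegrable (by fun_prop) _ _)
    exact Eventually.of_forall fun θ hθ => ker_norm_bound a b m h X θ hθ.1 hθ.2
  | succ r ih =>
    intro a b h
    obtain ⟨C1, hC1, h1⟩ := ih (a+1) b (by omega)
    obtain ⟨C2, hC2, h2⟩ := ih (a+2) (b-1) (by omega)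
    obtain ⟨C3, hC3, h3⟩ := ih (a+2) (b+1) (by omega)
    refine ⟨(a+1) * C1 + b * C2 + C3 * 2^(a+b+3+r), by positivity, fun m hm X hX => ?_⟩
    have k1 := h1 m (by omega) X hX
    have k2 := h2 (m+1) (by omega) X hX
    have k3 := h3 (m-1) (by omega) X hX
    have hs := congrArg norm (JJ_step a b m h (by omega) X)
    rw [norm_mul, norm_mul, Complex.norm_I, mul_one, Complex.norm_real, Real.norm_eq_abs] at hs
    have hX' : 0 < |X| := abs_pos.mpr hX
    have hm0 : (0:ℝ) < m := by exact_mod_cast (by omega : 0 < m)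
    have hsm : 0 < √(m:ℝ) := sqrt_pos.mpr hm0
    have hle : |X| * ‖JJ a b m X‖ ≤ (a+1) * ‖JJ (a+1) b m X‖ + b * ‖JJ (a+2) (b-1) (m+1) X‖
       + m * ‖JJ (a+2) (b+1) (m-1) X‖ := by
      rw [hs]
      refine (norm_add_le _ _).trans ?_
      refine (add_le_add_left (norm_sub_le _ _) _).trans ?_
      rw [norm_neg, norm_mul, norm_mul, norm_mul]
      have : ‖(a:ℂ) + 1‖ = a + 1 := by
        have : (a:ℂ) + 1 = ((a+1:ℕ):ℂ) := by push_cast; ring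
        rw [this, Complex.norm_natCast]; push_cast; ring
      rw [this, Complex.norm_natCast, Complex.norm_natCast]
    have B1 : (a+1) * ‖JJ (a+1) b m X‖ ≤ (a+1) * C1 / (|X|^r * √m ^ (a+b+(r+1))) := by
      rw [mul_div_assoc]; gcongr
      rw [show a+b+(r+1) = a+1+b+r by ring]; exact k1
    have B2 : b * ‖JJ (a+2) (b-1) (m+1) X‖ ≤ b * C2 / (|X|^r * √m ^ (a+b+(r+1))) := by
      rcases Nat.eq_zero_or_pos b with hb | hb
      · simp [hb]
      rw [mul_div_assoc]; gcongr
      refine k2.trans ?_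
      rw [show a+2+(b-1)+r = a+b+(r+1) by omega]
      gcongr
      omega
    have B3 : m * ‖JJ (a+2) (b+1) (m-1) X‖ ≤ C3 * 2^(a+b+3+r) / (|X|^r * √m ^ (a+b+(r+1))) := by
      have hq : √(m:ℝ) / 2 ≤ √((m-1:ℕ):ℝ) := by
        apply le_sqrt_of_sq_le
        rw [div_pow, sq_sqrt hm0.le, Nat.cast_sub (by omega)]
        have : (2:ℝ) ≤ m := by exact_mod_cast (by omega : 2 ≤ m)
        push_cast; linarith
      calc (m:ℝ) * ‖JJ (a+2) (b+1) (m-1) X‖ ≤ m * (C3 / (|X|^r * (√(m:ℝ)/2) ^ (a+2+(b+1)+r))) := by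
            gcongr
            refine k3.trans ?_
            gcongr
        _ = _ := by
            rw [show a+2+(b+1)+r = a+b+3+r by ring, div_pow]
            nth_rewrite 1 [← sq_sqrt hm0.le]
            rw [show a+b+(r+1) = (a+b+r)+1 by ring, show a+b+3+r = (a+b+r)+3 by ring]
            field_simp
            try ring
    have : |X| * ‖JJ a b m X‖ ≤ ((a+1) * C1 + b * C2 + C3 * 2^(a+b+3+r)) / (|X|^r * √m ^ (a+b+(r+1))) := by
      rw [add_div, add_div]; linarith
    rw [le_div_iff₀ (by positivity)] at this ⊢
    refine le_trans (le_of_eq ?_) this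
    ring

noncomputable def rho (n j : ℕ) (y : ℝ) : ℝ :=
  4 / max y (2*j) * (cos (π * j / max y (2*j)) ^ n * sin (π * j / max y (2*j)) ^ 2)

theorem rho_zero (n j : ℕ) (hn : 1 ≤ n) (hj : 1 ≤ j) (y : ℝ) (hy : y ≤ 2 * j) : rho n j y = 0 := by
  have hj' : (0:ℝ) < j := by exact_mod_cast hj
  unfold rho
  rw [max_eq_right hy, show π * j / (2 * j) = π / 2 by field_simp, cos_pi_div_two,
    zero_pow (by omega)]
  simp

theorem rho_of_lt (n j : ℕ) (y : ℝ) (hy : 2 * j ≤ y) :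
    rho n j y = 4 / y * (cos (π * j / y) ^ n * sin (π * j / y) ^ 2) := by
  unfold rho
  rw [max_eq_left hy]

theorem rho_cont (n j : ℕ) (hj : 1 ≤ j) : Continuous (rho n j) := by
  have hj' : (0:ℝ) < j := by exact_mod_cast hj
  have : ∀ y : ℝ, max y (2*(j:ℝ)) ≠ 0 := fun y => by
    have := le_max_right y (2*(j:ℝ))
    intro h; linarith
  unfold rho
  fun_prop (disch := assumption)

theorem rho_decay (n j : ℕ) (hn : 1 ≤ n) (hj : 1 ≤ j) (y : ℝ) :
    |rho n j y| ≤ 4 * (π * j)^2 / |y| ^ 3 := by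
  have hj' : (0:ℝ) < j := by exact_mod_cast hj
  rcases le_or_gt y (2*j) with h | h
  · rw [rho_zero n j hn hj y h, abs_zero]; positivity
  · have hy : 0 < y := by linarith
    rw [rho_of_lt n j y h.le, abs_mul, abs_mul, abs_pow, abs_pow, abs_div, abs_of_pos hy]
    have h1 : |cos (π * j / y)| ^ n ≤ 1 := pow_le_one₀ (abs_nonneg _) (abs_cos_le_one _)
    have h2 : |sin (π * j / y)| ^ 2 ≤ (π * j / y)^2 := by
      have : |sin (π * j / y)| ≤ |π * j / y| := abs_sin_le_abs
      rw [← sq_abs (π * j / y)]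
      gcongr
    calc |(4:ℝ)| / y * (|cos (π * j / y)| ^ n * |sin (π * j / y)| ^ 2)
        ≤ |(4:ℝ)| / y * (1 * (π * j / y)^2) := by gcongr
      _ = _ := by rw [abs_of_pos (by norm_num)]; field_simp

theorem summable_shift (n : ℕ) : Summable (fun i : ℤ => 1 / |(n:ℝ) + 2 * i| ^ (3/2:ℝ)) := by
  have := (Real.summable_one_div_int_add_rpow (n/2) (3/2)).mpr (by norm_num)
  refine (this.mul_left ((1/2:ℝ)^(3/2:ℝ))).congr fun i => ?_
  rw [show (n:ℝ) + 2 * i = 2 * (i + n/2) by ring, abs_mul, mul_rpow (by positivity) (by positivity),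
    abs_of_pos (by norm_num : (0:ℝ) < 2), one_div 2, inv_rpow (by norm_num)]
  field_simp

theorem summable_shift3 (n : ℕ) : Summable (fun i : ℤ => 1 / |(n:ℝ) + 2 * i| ^ 3) := by
  have := (Real.summable_one_div_int_add_rpow (n/2) 3).mpr (by norm_num)
  refine (this.mul_left (1/8)).congr fun i => ?_
  rw [show (n:ℝ) + 2 * i = 2 * (i + n/2) by ring, abs_mul,
    abs_of_pos (by norm_num : (0:ℝ) < 2), mul_pow, show (3:ℝ) = (3:ℕ) by norm_num, rpow_natCast]
  field_simp
  norm_num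

theorem rho_summable (n j : ℕ) (hn : 1 ≤ n) (hj : 1 ≤ j) :
    Summable (fun i : ℤ => rho n j (n + 2 * i)) := by
  refine Summable.of_norm_bounded ((summable_shift3 n).mul_left (4 * (π * j)^2)) fun i => ?_
  refine (rho_decay n j hn hj _).trans (le_of_eq ?_)
  ring

theorem rho_fourier (n j : ℕ) (hn : 1 ≤ n) (hj : 1 ≤ j) (l : ℝ) :
    FourierTransform.fourier (fun x : ℝ => ((rho n j (2*x) : ℝ) : ℂ)) l = 2 * JJ 0 2 n (π^2 * j * l) := by
  have hj' : (0:ℝ) < j := by exact_mod_cast hj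
  rw [Real.fourier_real_eq_integral_exp_smul]
  rw [← setIntegral_eq_integral_of_forall_compl_eq_zero (s := Ioi (j:ℝ))]
  swap
  · intro x hx
    rw [rho_zero n j hn hj (2*x) (by simp at hx; linarith)]
    simp
  have him : (fun θ : ℝ => π * j / (2 * θ)) '' Ioo 0 (π/2) = Ioi (j:ℝ) := by
    ext x
    simp only [mem_image, mem_Ioo, mem_Ioi]
    constructor
    · rintro ⟨θ, ⟨h0, h1⟩, rfl⟩
      rw [lt_div_iff₀ (by positivity)]
      nlinarith
    · intro hx
      have hx0 : 0 < x := hj'.trans hx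
      refine ⟨π * j / (2 * x), ⟨by positivity, ?_⟩, by field_simp⟩
      rw [div_lt_div_iff₀ (by positivity) (by positivity)]
      nlinarith [pi_pos]
  rw [← him, integral_image_eq_integral_abs_deriv_smul (f' := fun θ => -(π * j / (2 * θ^2))) measurableSet_Ioo]
  rotate_left
  · intro θ hθ
    have h0 : θ ≠ 0 := hθ.1.ne'
    have := ((hasDerivAt_inv h0).const_mul (π * j / 2)).hasDerivWithinAt (s := Ioo 0 (π/2))
    refine (this.congr_deriv ?_).congr_of_eventuallyEq ?_ ?_
    · field_simp
    · exact Eventually.of_forall fun y => by field_simp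
    · field_simp
  · intro x hx y hy hxy
    have h0 : x ≠ 0 := hx.1.ne'
    have h1 : y ≠ 0 := hy.1.ne'
    simp only at hxy
    field_simp at hxy
    linarith
  unfold JJ
  rw [intervalIntegral.integral_of_le (by positivity), integral_Ioc_eq_integral_Ioo, ← integral_const_mul]
  refine setIntegral_congr_fun measurableSet_Ioo fun θ hθ => ?_
  have h0 : 0 < θ := hθ.1
  have hC : (θ:ℂ) ≠ 0 := by exact_mod_cast h0.ne'
  have hjC : (j:ℂ) ≠ 0 := by exact_mod_cast hj'.ne'
  have hpC : (π:ℂ) ≠ 0 := by exact_mod_cast pi_ne_zero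
  rw [rho_of_lt n j _ (by
    rw [show 2 * (π * j / (2 * θ)) = π * j / θ by field_simp, le_div_iff₀ h0]
    nlinarith [hθ.2])]
  rw [show 2 * (π * j / (2 * θ)) = π * j / θ by field_simp, show π * j / (π * j / θ) = θ by field_simp]
  rw [abs_neg, abs_of_pos (by positivity)]
  unfold kerF osc
  rw [show -2 * π * (π * j / (2 * θ)) * l = -(π ^ 2 * j * l / θ) by field_simp]
  rw [Complex.real_smul, smul_eq_mul]
  push_cast
  field_simp
  ring

theorem JJ_zero (n : ℕ) : JJ 0 2 n 0 = ((TT n : ℝ) : ℂ) := by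
  unfold JJ TT
  rw [← intervalIntegral.integral_ofReal]
  congr 1
  ext θ
  unfold kerF osc
  simp
  ring

theorem poisson_rho : ∃ C : ℝ, 0 ≤ C ∧ ∀ n : ℕ, 13 ≤ n → ∀ j : ℕ, 1 ≤ j →
    |∑' i : ℤ, rho n j (n + 2 * i) - 2 * TT n| ≤ C / n ^ 7 * (1 / (j:ℝ)^2) := by
  obtain ⟨C, hC, hb⟩ := JJ_bound 12 0 2 (by norm_num)
  have hsum : Summable (fun l : ℤ => 1 / (l:ℝ)^2) := Real.summable_one_div_int_pow.mpr (by norm_num)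
  refine ⟨2 * C * ∑' l : ℤ, 1 / (l:ℝ)^2, ?_, fun n hn j hj => ?_⟩
  · have : 0 ≤ ∑' l : ℤ, 1 / (l:ℝ)^2 := tsum_nonneg fun l => by positivity
    positivity
  have hj1 : (1:ℝ) ≤ j := by exact_mod_cast hj
  have hn1 : (0:ℝ) < n := by exact_mod_cast (by omega : 0 < n)
  set f : ℝ → ℂ := fun x : ℝ => ((rho n j (2*x) : ℝ) : ℂ) with hf
  have hF : ∀ l : ℤ, FourierTransform.fourier f (l:ℝ) = 2 * JJ 0 2 n (π^2 * j * l) := fun l =>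
    rho_fourier n j (by omega) hj l
  have hbd : ∀ l : ℤ, l ≠ 0 → ‖FourierTransform.fourier f (l:ℝ)‖ ≤ 2 * C / n^7 * (1/(j:ℝ)^2) * (1 / (l:ℝ)^2) := by
    intro l hl
    have hl' : (l:ℝ) ≠ 0 := by exact_mod_cast hl
    have hl1 : (1:ℝ) ≤ |(l:ℝ)| := by
      rw [← Int.cast_abs]; exact_mod_cast Int.one_le_abs hl
    rw [hF, norm_mul]
    have := hb n hn (π^2 * j * l) (by positivity)
    have hsq : √(n:ℝ) ^ (0 + 2 + 12) = n^7 := by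
      rw [show 0 + 2 + 12 = 2 * 7 by norm_num, pow_mul, sq_sqrt hn1.le]
    rw [hsq] at this
    have hge : (j:ℝ)^2 * (l:ℝ)^2 ≤ |π^2 * j * l| ^ 12 := by
      rw [← sq_abs (l:ℝ), ← mul_pow]
      have hp : 1 ≤ π^2 := by nlinarith [pi_gt_three]
      have h1 : (1:ℝ) ≤ j * |(l:ℝ)| := by nlinarith
      have h2 : (j:ℝ) * |(l:ℝ)| ≤ |π^2 * j * l| := by
        rw [abs_mul, abs_mul, abs_of_pos (by positivity : 0 < π^2), abs_of_pos (by linarith : (0:ℝ) < j)]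
        nlinarith
      calc ((j:ℝ) * |(l:ℝ)|)^2 ≤ ((j:ℝ) * |(l:ℝ)|)^12 := pow_le_pow_right₀ h1 (by norm_num)
        _ ≤ _ := by gcongr
    have h3 : C / (|π^2 * j * l| ^ 12 * n^7) ≤ C / ((j:ℝ)^2 * (l:ℝ)^2 * n^7) := by gcongr
    rw [Complex.norm_ofNat]
    calc 2 * ‖JJ 0 2 n (π^2 * j * l)‖ ≤ 2 * (C / ((j:ℝ)^2 * (l:ℝ)^2 * n^7)) := by linarith
      _ = _ := by field_simp
  have hS : Summable (fun l : ℤ => FourierTransform.fourier f (l:ℝ)) := by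
    refine Summable.of_norm_bounded_eventually (g := fun l : ℤ => 2 * C / n^7 * (1/(j:ℝ)^2) * (1 / (l:ℝ)^2)) (hsum.mul_left _) ?_
    rw [eventually_cofinite]
    refine (finite_singleton (0:ℤ)).subset fun l hl => ?_
    by_contra h
    exact hl (hbd l h)
  have hP := Real.tsum_eq_tsum_fourier_of_rpow_decay_of_summable (f := f)
    (Complex.continuous_ofReal.comp ((rho_cont n j hj).comp (by fun_prop))) (b := 3) (by norm_num) (by
      refine Asymptotics.IsBigO.of_bound (4 * (π * j)^2 / 8) (Eventually.of_forall fun x => ?_)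
      rw [hf, Complex.norm_real]
      refine (rho_decay n j (by omega) hj _).trans (le_of_eq ?_)
      rw [rpow_neg (by positivity), show (3:ℝ) = (3:ℕ) by norm_num, rpow_natCast, norm_inv, norm_pow,
        Real.norm_eq_abs, abs_abs, abs_mul, mul_pow, abs_of_pos (by norm_num : (0:ℝ) < 2)]
      ring) hS (n/2)
  have hL : ∑' i : ℤ, f (n/2 + i) = ((∑' i : ℤ, rho n j (n + 2 * i) : ℝ) : ℂ) := by
    rw [Complex.ofReal_tsum]
    refine tsum_congr fun i => ?_
    rw [hf]
    simp only
    congr 2; ring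
  rw [hL] at hP
  set a : ℤ → ℂ := fun l => FourierTransform.fourier f (l:ℝ) * fourier l ((n/2 : ℝ) : UnitAddCircle) with ha
  have hna : ∀ l, ‖a l‖ = ‖FourierTransform.fourier f (l:ℝ)‖ := by
    intro l
    rw [ha]; simp only [norm_mul]
    rw [fourier_apply, Circle.norm_coe, mul_one]
  have hSa : Summable a := by
    refine Summable.of_norm ?_
    simp only [hna]
    exact hS.norm
  have ha0 : a 0 = ((2 * TT n : ℝ) : ℂ) := by
    rw [ha]; simp only [hF]
    simp [JJ_zero]
  have h4 := hSa.hasSum.sub (hasSum_ite_eq (0:ℤ) (a 0))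
  rw [← hP, ha0, ← Complex.ofReal_sub] at h4
  have h5 : ‖∑' l : ℤ, (a l - if l = 0 then ((2 * TT n : ℝ) : ℂ) else 0)‖ ≤ 2 * C / n^7 * (1/(j:ℝ)^2) * ∑' l : ℤ, 1 / (l:ℝ)^2 := by
    refine tsum_of_norm_bounded (hsum.hasSum.mul_left _) fun l => ?_
    by_cases hl : l = 0
    · subst hl; simp [ha0]
    · rw [if_neg hl, sub_zero, hna]; exact hbd l hl
  rw [h4.tsum_eq, Complex.norm_real, Real.norm_eq_abs] at h5
  refine h5.trans (le_of_eq ?_)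
  ring

theorem walkSum_snoc_le (n : ℕ) (b : Bool) (ε : Fin n → Bool) (k : ℕ) (hk : k ≤ n) :
    walkSum (n+1) (Fin.snoc ε b : Fin (n+1) → Bool) k = walkSum n ε k := by
  unfold walkSum
  rw [Fin.sum_univ_castSucc]
  simp [hk]

theorem walkSum_snoc_last (n : ℕ) (b : Bool) (ε : Fin n → Bool) :
    walkSum (n+1) (Fin.snoc ε b : Fin (n+1) → Bool) (n+1) = walkSum n ε n + (if b then 1 else -1) := by
  unfold walkSum
  rw [Fin.sum_univ_castSucc]
  simp only [Fin.snoc_castSucc, Fin.snoc_last, Fin.val_castSucc, Fin.val_last, Fin.is_lt, if_true, Nat.lt_succ_self]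
  congr 1
  refine Finset.sum_congr rfl fun i _ => ?_
  rw [if_pos (by omega)]

def Adm (n h : ℕ) (k : ℤ) (ε : Fin n → Bool) : Prop :=
  (∀ j ≤ n, 0 ≤ walkSum n ε j ∧ walkSum n ε j ≤ (h:ℤ)) ∧ walkSum n ε n = k

theorem adm_snoc (n h : ℕ) (k : ℤ) (b : Bool) (ε : Fin n → Bool) :
    Adm (n+1) h k (Fin.snoc ε b : Fin (n+1) → Bool) ↔
      (0 ≤ k ∧ k ≤ h) ∧ Adm n h (k - (if b then 1 else -1)) ε := by
  unfold Adm
  rw [walkSum_snoc_last]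
  constructor
  · rintro ⟨h1, h2⟩
    have h3 := h1 (n+1) le_rfl
    rw [walkSum_snoc_last, h2] at h3
    refine ⟨h3, fun j hj => ?_, by linarith⟩
    have := h1 j (by omega)
    rwa [walkSum_snoc_le n b ε j hj] at this
  · rintro ⟨h1, h2, h3⟩
    refine ⟨fun j hj => ?_, by linarith⟩
    rcases Nat.lt_or_ge n j with hj' | hj'
    · obtain rfl : j = n + 1 := by omega
      rw [walkSum_snoc_last, h3]
      simpa using h1
    · rw [walkSum_snoc_le n b ε j hj']
      exact h2 j hj'

open Classical in
noncomputable def NN (n h : ℕ) (k : ℤ) : ℝ := ∑ ε : Fin n → Bool, if Adm n h k ε then 1 else 0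

theorem W_eq_NN (n h : ℕ) : (W n h : ℝ) = NN n h h := by
  classical
  unfold W NN
  rw [Nat.card_eq_fintype_card, Fintype.card_subtype, Finset.sum_boole]
  unfold Adm
  congr!

theorem NN_succ_out (n h : ℕ) (k : ℤ) (hk : ¬ (0 ≤ k ∧ k ≤ h)) : NN n h k = 0 := by
  unfold NN
  refine Finset.sum_eq_zero fun ε _ => ?_
  rw [if_neg]
  rintro ⟨h1, h2⟩
  exact hk (h2 ▸ h1 n le_rfl)

theorem NN_succ (n h : ℕ) (k : ℤ) (hk : 0 ≤ k ∧ k ≤ h) :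
    NN (n+1) h k = NN n h (k-1) + NN n h (k+1) := by
  unfold NN
  rw [← (Fin.snocEquiv (fun _ : Fin (n+1) => Bool)).sum_comp, Fintype.sum_prod_type]
  rw [Fintype.sum_bool]
  congr 1
  · refine Finset.sum_congr rfl fun ε _ => ?_
    have := adm_snoc n h k true ε
    simp only [hk, true_and, and_self, if_true] at this
    congr 1
    exact propext this
  · refine Finset.sum_congr rfl fun ε _ => ?_
    have := adm_snoc n h k false ε
    simp only [hk, true_and, and_self] at this
    congr 1
    refine propext (this.trans ?_)
    simp

theorem NN_zero (h : ℕ) (k : ℤ) : NN 0 h k = if k = 0 then 1 else 0 := by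
  unfold NN
  rw [Fintype.sum_unique]
  congr 1
  unfold Adm walkSum
  simp
  exact eq_comm

theorem W_parity (n h : ℕ) (hp : ¬ Even (n+h)) : W n h = 0 := by
  have key : ∀ n h : ℕ, ∀ k : ℤ, ¬ Even (n+k) → NN n h k = 0 := by
    intro n h
    induction n with
    | zero =>
      intro k hk
      rw [NN_zero, if_neg]
      rintro rfl
      simp at hk
    | succ n ih =>
      intro k hk
      by_cases hr : 0 ≤ k ∧ k ≤ h
      · rw [NN_succ n h k hr, ih, ih, add_zero]
        · intro h'; apply hk; push_cast; rwa [add_right_comm, add_assoc]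
        · rintro ⟨r, hr⟩; apply hk; exact ⟨r + 1, by push_cast; omega⟩
      · exact NN_succ_out _ _ _ hr
  have := key n h h (by exact_mod_cast hp)
  rw [← W_eq_NN] at this
  exact_mod_cast this

theorem cos_sum_tele (x : ℝ) (m : ℕ) : 2 * sin (x/2) * ∑ j ∈ Finset.range m, cos (j * x) =
    sin ((m - 1/2) * x) + sin (x/2) := by
  induction m with
  | zero =>
    simp
    rw [show 2⁻¹ * x = x/2 by ring]; ring
  | succ m ih =>
    rw [Finset.sum_range_succ, mul_add, ih]
    have e1 : (((m+1:ℕ):ℝ) - 1/2) * x = m * x + x/2 := by push_cast; ring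
    have e2 : ((m:ℝ) - 1/2) * x = m * x - x/2 := by ring
    rw [e1, e2, sin_add, sin_sub]; ring

theorem cos_sum_val (m k : ℕ) (hk : 0 < k) (hk2 : k < 2 * m) :
    ∑ j ∈ Finset.range m, cos (k * (π * j / m)) = (1 - (-1)^k) / 2 := by
  have hm : (0:ℝ) < m := by exact_mod_cast (by omega : 0 < m)
  have hk' : (0:ℝ) < k := by exact_mod_cast hk
  have hk2' : (k:ℝ) < 2 * m := by exact_mod_cast hk2
  have := cos_sum_tele (k * π / m) m
  have e : ((m:ℝ) - 1/2) * (k * π / m) = k * π - k * π / m / 2 := by field_simp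
  have hs : sin (k * π / m / 2) ≠ 0 := by
    apply ne_of_gt
    apply sin_pos_of_pos_of_lt_pi (by positivity)
    rw [div_div, div_lt_iff₀ (by positivity)]
    nlinarith [pi_pos]
  rw [e, sin_sub, sin_nat_mul_pi, cos_nat_mul_pi] at this
  have h2 : ∑ j ∈ Finset.range m, cos (k * (π * j / m)) = ∑ j ∈ Finset.range m, cos (j * (k * π / m)) := by
    refine Finset.sum_congr rfl fun j _ => ?_
    congr 1; ring
  rw [h2]
  apply mul_left_cancel₀ hs
  linarith

theorem orth (m : ℕ) (hm : 2 ≤ m) (k : ℤ) (h0 : -1 ≤ k) (h1 : k ≤ m - 1) :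
    2 / (m:ℝ) * ∑ j ∈ Finset.range m, sin (π * j / m) * sin ((k+1) * (π * j / m)) = if k = 0 then 1 else 0 := by
  have hm0 : (0:ℝ) < m := by exact_mod_cast (by omega : 0 < m)
  have e : ∀ j : ℕ, sin (π * j / m) * sin ((k+1) * (π * j / m)) =
      (cos (k * (π * j / m)) - cos ((k+2) * (π * j / m))) / 2 := by
    intro j
    set t := π * j / m
    have a1 : (k:ℝ) * t = (k+1) * t - t := by ring
    have a2 : ((k:ℝ)+2) * t = (k+1) * t + t := by ring
    rw [a1, a2, cos_sub, cos_add]; ring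
  simp only [e]
  rw [← Finset.sum_div, Finset.sum_sub_distrib]
  rcases lt_or_ge k 0 with hk | hk
  · obtain rfl : k = -1 := by omega
    have : ∀ j : ℕ, cos (((-1:ℤ):ℝ) * (π * j / m)) = cos ((((-1:ℤ):ℝ)+2) * (π * j / m)) := by
      intro j; rw [← cos_neg]; congr 1; push_cast; ring
    rw [Finset.sum_congr rfl (fun j _ => this j), sub_self, if_neg (by norm_num)]
    simp
  · obtain ⟨k, rfl⟩ := Int.eq_ofNat_of_zero_le hk
    have h2 := cos_sum_val m (k+2) (by omega) (by omega)
    push_cast at h2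
    push_cast
    rw [h2]
    rcases Nat.eq_zero_or_pos k with hk0 | hk0
    · subst hk0
      simp [hm0.ne']
    · rw [cos_sum_val m k hk0 (by omega), if_neg (by exact_mod_cast hk0.ne')]
      rw [pow_add]; norm_num

theorem NN_formula (h n : ℕ) : ∀ k : ℤ, -1 ≤ k → k ≤ h + 1 →
    NN n h k = 2 / ((h+2:ℕ):ℝ) * ∑ j ∈ Finset.range (h+2), (2 * cos (π * j / ((h+2:ℕ):ℝ)))^n *
      (sin (π * j / ((h+2:ℕ):ℝ)) * sin ((k+1) * (π * j / ((h+2:ℕ):ℝ)))) := by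
  induction n with
  | zero =>
    intro k h0 h1
    rw [NN_zero]
    simp only [pow_zero, one_mul]
    rw [orth (h+2) (by omega) k h0 (by push_cast; omega)]
  | succ n ih =>
    intro k h0 h1
    by_cases hr : 0 ≤ k ∧ k ≤ h
    · rw [NN_succ n h k hr, ih (k-1) (by omega) (by omega), ih (k+1) (by omega) (by omega), ← mul_add,
        ← Finset.sum_add_distrib]
      congr 1
      refine Finset.sum_congr rfl fun j _ => ?_
      set t := π * j / ((h+2:ℕ):ℝ)
      have a1 : (((k-1:ℤ):ℝ)+1) * t = (k+1) * t - t := by push_cast; ring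
      have a2 : (((k+1:ℤ):ℝ)+1) * t = (k+1) * t + t := by push_cast; ring
      rw [a1, a2, sin_sub, sin_add]; ring
    · rw [NN_succ_out _ _ _ hr]
      symm
      rw [mul_eq_zero]; right
      refine Finset.sum_eq_zero fun j _ => ?_
      have : sin (((k:ℝ)+1) * (π * j / ((h+2:ℕ):ℝ))) = 0 := by
        have : k = -1 ∨ k = h + 1 := by omega
        rcases this with rfl | rfl
        · simp
        · have e : (((h+1:ℤ):ℝ)+1) * (π * j / ((h+2:ℕ):ℝ)) = j * π := by
            push_cast
            field_simp
            ring
          rw [e, sin_nat_mul_pi]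
      rw [this]; simp

theorem W_spectral (n h : ℕ) (hn : 1 ≤ n) (hp : Even (n+h)) :
    (W n h : ℝ) / 2^n = ∑ j ∈ Finset.range (h+2), (-1)^j * rho n (j+1) (h+2) := by
  set m : ℝ := (h:ℝ) + 2 with hm
  have hm0 : 0 < m := by positivity
  have hmc : ((h+2:ℕ):ℝ) = m := by push_cast; rfl
  let t : ℕ → ℝ := fun j => -(-1)^j * (cos (π * j / m)^n * sin (π * j / m)^2)
  let s : ℕ → ℝ := fun j => if 2 * j < h + 2 then t j else 0
  have h1 : (W n h : ℝ) / 2^n = 2 / m * ∑ j ∈ Finset.range (h+2), t j := by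
    rw [W_eq_NN, NN_formula h n h (by omega) (by omega), hmc, mul_div_assoc, Finset.sum_div]
    congr 1
    refine Finset.sum_congr rfl fun j _ => ?_
    have e : (((h:ℤ):ℝ)+1) * (π * j / m) = j * π - π * j / m := by
      push_cast
      field_simp
      rw [hm]; ring
    rw [e, sin_sub, sin_nat_mul_pi, cos_nat_mul_pi, mul_pow]
    simp only [t]
    field_simp
    ring
  have htm : t (h+2) = 0 := by
    simp only [t]
    rw [hmc, mul_div_assoc, div_self hm0.ne', mul_one, sin_pi]; simp
  have hrefl : ∀ j ∈ Finset.range (h+2+1), t j = s j + s (h+2-j) := by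
    intro j hj
    have hj' : j ≤ h + 2 := by simp at hj; omega
    have hr : t (h+2-j) = t j := by
      simp only [t]
      have e : π * ((h+2-j:ℕ):ℝ) / m = π - π * j / m := by
        rw [Nat.cast_sub hj', hmc]; field_simp
      rw [e, cos_pi_sub, sin_pi_sub, neg_pow (cos _)]
      have e2 : (-1:ℝ)^(h+2-j) * (-1)^n = (-1)^j := by
        rw [← pow_add]
        have : (-1:ℝ)^(h+2-j+n) * (-1)^j = 1 := by
          rw [← pow_add, show h+2-j+n+j = n+h+2 by omega]
          exact Even.neg_one_pow (hp.add (by norm_num))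
        have h3 : (-1:ℝ)^j * (-1)^j = 1 := by rw [← mul_pow]; norm_num
        calc (-1:ℝ)^(h+2-j+n) = (-1)^(h+2-j+n) * ((-1)^j * (-1)^j) := by rw [h3, mul_one]
          _ = _ := by rw [← mul_assoc, this, one_mul]
      linear_combination (-(cos (π * j / m)^n * sin (π * j / m)^2)) * e2
    simp only [s]
    rcases lt_trichotomy (2*j) (h+2) with hlt | heq | hgt
    · rw [if_pos hlt, if_neg (by omega), add_zero]
    · rw [if_neg (by omega), if_neg (by omega)]
      simp only [t]
      have : π * j / m = π / 2 := by
        rw [← hmc, ← heq]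
        have : (j:ℝ) ≠ 0 := by
          have : j ≠ 0 := by omega
          exact_mod_cast this
        push_cast; field_simp
      rw [this, cos_pi_div_two, zero_pow (by omega)]; simp
    · rw [if_neg (by omega), if_pos (by omega), hr, zero_add]
  have h2 : ∑ j ∈ Finset.range (h+2), t j = 2 * ∑ j ∈ Finset.range (h+2+1), s j := by
    have : ∑ j ∈ Finset.range (h+2+1), t j = ∑ j ∈ Finset.range (h+2), t j := by
      rw [Finset.sum_range_succ, htm, add_zero]
    rw [← this, Finset.sum_congr rfl hrefl, Finset.sum_add_distrib]
    have := Finset.sum_range_reflect s (h+2+1)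
    simp only [Nat.add_sub_cancel] at this
    rw [this]; ring
  have hs0 : s 0 = 0 := by simp [s, t]
  rw [h1, h2, Finset.sum_range_succ', hs0, add_zero, ← mul_assoc, Finset.mul_sum]
  refine Finset.sum_congr rfl fun j _ => ?_
  simp only [s]
  split_ifs with hj
  · have : (2:ℝ) * ((j+1:ℕ):ℝ) ≤ m := by rw [← hmc]; exact_mod_cast hj.le
    rw [rho_of_lt n (j+1) m this]
    simp only [t]
    rw [pow_succ]; ring
  · rw [rho_zero n (j+1) hn (by omega) m (by rw [← hmc]; exact_mod_cast (not_lt.mp hj))]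
    simp

noncomputable def gF (n : ℕ) (θ : ℝ) : ℝ := cos θ ^ n * sin θ ^ 2

theorem gF_second_diff (n : ℕ) : ∃ K : ℝ, 0 ≤ K ∧ ∀ x t : ℝ, 0 ≤ x → 0 ≤ t → x + 2 * t ≤ π/2 →
    |gF n x - 2 * gF n (x+t) + gF n (x+2*t)| ≤ K * t^2 := by
  have hg : ContDiff ℝ (1+1) (gF n) := by unfold gF; fun_prop
  have hg1 : ContDiff ℝ 1 (deriv (gF n)) := ContDiff.deriv' hg
  have hd : Differentiable ℝ (gF n) := hg.differentiable (by norm_num)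
  have hd1 : Differentiable ℝ (deriv (gF n)) := hg1.differentiable (by norm_num)
  have hc2 : Continuous (deriv (deriv (gF n))) := hg1.continuous_deriv (by norm_num)
  obtain ⟨K, hK⟩ := isCompact_Icc.exists_bound_of_continuousOn (s := Icc (0:ℝ) (π/2)) hc2.continuousOn
  have hK0 : 0 ≤ K := (norm_nonneg _).trans (hK 0 ⟨le_rfl, by positivity⟩)
  refine ⟨K, hK0, fun x t hx ht h => ?_⟩
  have hLip : ∀ s ∈ Icc x (x+t), ‖deriv (gF n) (s+t) - deriv (gF n) s‖ ≤ K * t := by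
    intro s hs
    have := Convex.norm_image_sub_le_of_norm_deriv_le (f := deriv (gF n)) (fun y _ => hd1 y) hK (convex_Icc _ _)
      (x := s) (y := s+t) ⟨by linarith [hs.1], by linarith [hs.2]⟩ ⟨by linarith [hs.1], by linarith [hs.2]⟩
    simpa [abs_of_nonneg ht] using this
  have hφ : ∀ s, HasDerivAt (fun s => gF n (s+t) - gF n s) (deriv (gF n) (s+t) - deriv (gF n) s) s := fun s =>
    (HasDerivAt.comp_add_const s t (hd (s+t)).hasDerivAt).sub (hd s).hasDerivAt
  have := Convex.norm_image_sub_le_of_norm_hasDerivWithin_le (f := fun s => gF n (s+t) - gF n s)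
    (fun s _ => (hφ s).hasDerivWithinAt) hLip (convex_Icc _ _)
    (x := x) (y := x+t) ⟨le_rfl, by linarith⟩ ⟨by linarith, le_rfl⟩
  rw [Real.norm_eq_abs, Real.norm_eq_abs, add_sub_cancel_left, abs_of_nonneg ht] at this
  calc |gF n x - 2 * gF n (x+t) + gF n (x+2*t)| = |gF n (x + t + t) - gF n (x + t) - (gF n (x + t) - gF n x)| := by
        congr 1; rw [show x + 2*t = x+t+t by ring]; ring
    _ ≤ K * t * t := this
    _ = _ := by ring

theorem gmin_second_diff (n : ℕ) (hn : 2 ≤ n) : ∃ K : ℝ, 0 ≤ K ∧ ∀ x t : ℝ, 0 ≤ x → 0 ≤ t →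
    |gF n (min x (π/2)) - 2 * gF n (min (x+t) (π/2)) + gF n (min (x+2*t) (π/2))| ≤ K * t^2 := by
  obtain ⟨K, hK, h⟩ := gF_second_diff n
  refine ⟨K + 16, by linarith, fun x t hx ht => ?_⟩
  rcases le_or_gt (x+2*t) (π/2) with h1 | h1
  · rw [min_eq_left (by linarith), min_eq_left (by linarith), min_eq_left h1]
    have := h x t hx ht h1
    nlinarith [sq_nonneg t]
  · have hb : ∀ y, x ≤ y → |gF n (min y (π/2))| ≤ 4 * t^2 := by
      intro y hy
      set z := min y (π/2) with hz
      have hz1 : z ≤ π/2 := min_le_right _ _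
      have hz2 : π/2 - 2*t ≤ z := le_min (by linarith) (by linarith)
      have hc : |cos z| ≤ 2*t := by
        rw [← sin_pi_div_two_sub]
        refine abs_sin_le_abs.trans ?_
        rw [abs_of_nonneg (by linarith)]; linarith
      unfold gF
      rw [abs_mul, abs_pow, abs_pow]
      calc |cos z|^n * |sin z|^2 ≤ |cos z|^2 * 1 := by
            gcongr ?_ * ?_
            · exact pow_le_pow_of_le_one (abs_nonneg _) (abs_cos_le_one _) hn
            · exact pow_le_one₀ (abs_nonneg _) (abs_sin_le_one _)
        _ ≤ (2*t)^2 * 1 := by gcongr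
        _ = _ := by ring
    have b1 := abs_le.mp (hb x le_rfl)
    have b2 := abs_le.mp (hb (x+t) (by linarith))
    have b3 := abs_le.mp (hb (x+2*t) (by linarith))
    have : 0 ≤ K * t^2 := by positivity
    rw [abs_le]
    constructor <;> nlinarith [b1.1, b1.2, b2.1, b2.2, b3.1, b3.2]

theorem rho_eq_gmin (n j : ℕ) (hn : 1 ≤ n) (hj : 1 ≤ j) (y : ℝ) (hy : 0 < y) :
    rho n j y = 4 / y * gF n (min (π * j / y) (π/2)) := by
  have hj' : (0:ℝ) < j := by exact_mod_cast hj
  rcases le_or_gt y (2*j) with h | h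
  · rw [rho_zero n j hn hj y h, min_eq_right]
    · simp [gF]; right; omega
    · rw [div_le_div_iff₀ (by norm_num) hy]; nlinarith [pi_pos]
  · rw [rho_of_lt n j y h.le, min_eq_left]
    · rfl
    · rw [div_le_div_iff₀ hy (by norm_num)]; nlinarith [pi_pos]

noncomputable def DD (n j : ℕ) (y : ℝ) : ℝ := rho n j y - 2 * rho n (j+1) y + rho n (j+2) y

theorem DD_zero (n j : ℕ) (hn : 1 ≤ n) (hj : 1 ≤ j) (y : ℝ) (hy : y ≤ 2 * j) : DD n j y = 0 := by
  unfold DD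
  rw [rho_zero n j hn hj y hy, rho_zero n (j+1) hn (by omega) y (by push_cast; linarith),
    rho_zero n (j+2) hn (by omega) y (by push_cast; linarith)]
  simp

theorem DD_bound (n : ℕ) (hn : 2 ≤ n) : ∃ K : ℝ, 0 ≤ K ∧ ∀ j : ℕ, 1 ≤ j → ∀ y : ℝ,
    |DD n j y| ≤ K * (1 / (j:ℝ)^(3/2:ℝ) * (1 / |y|^(3/2:ℝ))) := by
  obtain ⟨K, hK, h⟩ := gmin_second_diff n hn
  refine ⟨4 * K * π^2, by positivity, fun j hj y => ?_⟩
  have hj' : (0:ℝ) < j := by exact_mod_cast hj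
  rcases le_or_gt y (2*j) with hy | hy
  · rw [DD_zero n j (by omega) hj y hy, abs_zero]; positivity
  have hy0 : 0 < y := by linarith
  unfold DD
  rw [rho_eq_gmin n j (by omega) hj y hy0, rho_eq_gmin n (j+1) (by omega) (by omega) y hy0,
    rho_eq_gmin n (j+2) (by omega) (by omega) y hy0]
  have := h (π * j / y) (π / y) (by positivity) (by positivity)
  rw [show π * j / y + π / y = π * ((j+1:ℕ):ℝ) / y by push_cast; ring,
    show π * j / y + 2 * (π / y) = π * ((j+2:ℕ):ℝ) / y by push_cast; ring] at this
  have e : y^3 = y^(3/2:ℝ) * y^(3/2:ℝ) := by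
    rw [← rpow_add hy0, ← rpow_natCast]; norm_num
  rw [abs_of_pos hy0]
  calc _ = 4 / y * |gF n (min (π * j / y) (π/2)) - 2 * gF n (min (π * ((j+1:ℕ):ℝ) / y) (π/2)) + gF n (min (π * ((j+2:ℕ):ℝ) / y) (π/2))| := by
        rw [← abs_of_pos (by positivity : 0 < 4 / y), ← abs_mul, abs_of_pos (by positivity : 0 < 4 / y)]
        congr 1; ring
    _ ≤ 4 / y * (K * (π / y)^2) := by gcongr
    _ = 4 * K * π^2 * (1 / y^3) := by field_simp
    _ = 4 * K * π^2 * (1 / y^(3/2:ℝ) * (1 / y^(3/2:ℝ))) := by rw [e]; field_simp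
    _ ≤ _ := by
      gcongr
      linarith

theorem alt_sum (ρ : ℕ → ℝ) (M : ℕ) : 4 * ∑ j ∈ Finset.range M, (-1)^j * ρ (j+1) =
    3 * ρ 1 - ρ 2 + ∑ j ∈ Finset.range M, (-1)^j * (ρ (j+1) - 2 * ρ (j+1+1) + ρ (j+1+2))
      - (-1)^M * (3 * ρ (M+1) - ρ (M+2)) := by
  induction M with
  | zero => simp
  | succ M ih =>
    rw [Finset.sum_range_succ, Finset.sum_range_succ, mul_add, ih]
    rw [show M + 1 + 2 = M + 3 by ring, show M + 1 + 1 = M + 2 by ring]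
    ring

theorem V_eq (n : ℕ) (hn : 1 ≤ n) (y : ℤ) (hp : Even (n + y)) :
    (if 2 ≤ y then (W n (y-2).toNat : ℝ) / 2^n else 0) =
    3/4 * rho n 1 y - 1/4 * rho n 2 y + 1/4 * ∑' j : ℕ, (-1)^j * DD n (j+1) y := by
  split_ifs with h
  · obtain ⟨h', rfl⟩ : ∃ h' : ℕ, y = h' + 2 := ⟨(y-2).toNat, by omega⟩
    have e : (((h':ℤ) + 2 : ℤ) : ℝ) = (h':ℝ) + 2 := by push_cast; ring
    rw [show ((h':ℤ) + 2 - 2).toNat = h' by omega, e, W_spectral n h' hn (by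
      have : Even (((n + h' : ℕ) : ℤ) + 2) := by push_cast; rw [add_assoc]; exact hp
      have h2 : Even ((n + h' : ℕ) : ℤ) := by
        rcases this with ⟨r, hr⟩; exact ⟨r - 1, by omega⟩
      exact_mod_cast h2)]
    rw [tsum_eq_sum (s := Finset.range (h'+2))]
    swap
    · intro j hj
      rw [DD_zero n (j+1) hn (by omega), mul_zero]
      simp at hj
      have : (h':ℝ) + 2 ≤ j := by exact_mod_cast hj
      push_cast; linarith [(Nat.cast_nonneg j : (0:ℝ) ≤ j)]
    have := alt_sum (fun j => rho n j ((h':ℝ)+2)) (h'+2)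
    have z1 : rho n (h'+2+1) ((h':ℝ)+2) = 0 := rho_zero n _ hn (by omega) _ (by push_cast; linarith [(Nat.cast_nonneg h' : (0:ℝ) ≤ h')])
    have z2 : rho n (h'+2+2) ((h':ℝ)+2) = 0 := rho_zero n _ hn (by omega) _ (by push_cast; linarith [(Nat.cast_nonneg h' : (0:ℝ) ≤ h')])
    rw [z1, z2] at this
    unfold DD
    linarith
  · have hy : (y:ℝ) ≤ 1 := by exact_mod_cast (by omega : y ≤ 1)
    rw [rho_zero n 1 hn le_rfl _ (by push_cast; linarith), rho_zero n 2 hn (by omega) _ (by push_cast; linarith)]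
    have : ∀ j : ℕ, (-1:ℝ)^j * DD n (j+1) y = 0 := fun j => by
      rw [DD_zero n (j+1) hn (by omega) _ (by push_cast; linarith [(Nat.cast_nonneg j : (0:ℝ) ≤ j)]), mul_zero]
    simp [this]

theorem qAdm_eq_tsum (n : ℕ) (hn : 1 ≤ n) : qAdm n = ∑' i : ℤ,
    (3/4 * rho n 1 (n+2*i) - 1/4 * rho n 2 (n+2*i) + 1/4 * ∑' j : ℕ, (-1)^j * DD n (j+1) (n+2*i)) := by
  set V : ℤ → ℝ := fun y => if 2 ≤ y then (W n (y-2).toNat : ℝ) / 2^n else 0 with hV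
  have h1 : qAdm n = ∑' y, V y := by
    unfold qAdm
    rw [← tsum_div_const]
    have hi : Function.Injective (fun h : ℕ => (h:ℤ) + 2) := fun a b h => by simpa using h
    rw [← hi.tsum_eq]
    · refine tsum_congr fun h => ?_
      simp only [hV]
      rw [if_pos (by omega), show ((h:ℤ) + 2 - 2).toNat = h by omega]
    · intro y hy
      rw [Function.mem_support] at hy
      by_cases h : 2 ≤ y
      · exact ⟨(y-2).toNat, by simp only; omega⟩
      · exact absurd (by simp only [hV]; rw [if_neg h]) hy
  have hi : Function.Injective (fun i : ℤ => (n:ℤ) + 2 * i) := fun a b h => by simpa using h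
  rw [h1, ← hi.tsum_eq]
  · refine tsum_congr fun i => ?_
    have := V_eq n hn (n + 2 * i) ⟨n + i, by ring⟩
    simp only [hV]
    rw [this]
    push_cast
    rfl
  · intro y hy
    rw [Function.mem_support] at hy
    by_cases h : 2 ≤ y
    · by_cases hp : Even (n + (y-2).toNat)
      · obtain ⟨r, hr⟩ := hp
        exact ⟨r + 1 - n, by simp only; omega⟩
      · exact absurd (by simp only [hV]; rw [if_pos h, W_parity n _ hp]; simp) hy
    · exact absurd (by simp only [hV]; rw [if_neg h]) hy

theorem qAdm_TT : ∃ C : ℝ, 0 ≤ C ∧ ∀ n : ℕ, 13 ≤ n → |qAdm n - TT n| ≤ C / (n:ℝ)^7 := by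
  obtain ⟨C, hC, hP⟩ := poisson_rho
  have hz : Summable (fun j : ℕ => 1 / ((j+1:ℕ):ℝ)^2) :=
    (summable_nat_add_iff (f := fun j : ℕ => 1 / (j:ℝ)^2) 1).mpr (Real.summable_one_div_nat_pow.mpr (by norm_num))
  have hz0 : 0 ≤ ∑' j : ℕ, 1 / ((j+1:ℕ):ℝ)^2 := tsum_nonneg fun j => by positivity
  refine ⟨C + C * ∑' j : ℕ, 1 / ((j+1:ℕ):ℝ)^2, by positivity, fun n hn => ?_⟩
  have hn0 : (0:ℝ) < n := by exact_mod_cast (by omega : 0 < n)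
  obtain ⟨K, hK, hD⟩ := DD_bound n (by omega)
  have hn1 : 1 ≤ n := by omega
  have hn13 := hn
  set A : ℕ → ℝ := fun j => ∑' i : ℤ, rho n j (n + 2 * i) with hA
  have hAj : ∀ j : ℕ, 1 ≤ j → |A j - 2 * TT n| ≤ C / (n:ℝ)^7 * (1 / (j:ℝ)^2) := fun j hj => hP n hn13 j hj
  have hS : ∀ j : ℕ, 1 ≤ j → Summable (fun i : ℤ => rho n j (n + 2 * i)) := fun j hj => rho_summable n j hn1 hj
  have hz32 : Summable (fun j : ℕ => 1 / ((j+1:ℕ):ℝ)^(3/2:ℝ)) :=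
    (summable_nat_add_iff (f := fun j : ℕ => 1 / (j:ℝ)^(3/2:ℝ)) 1).mpr (Real.summable_one_div_nat_rpow.mpr (by norm_num))
  have hprod : Summable (fun p : ℤ × ℕ => (-1:ℝ)^p.2 * DD n (p.2+1) (n + 2 * p.1)) := by
    have := ((summable_shift n).mul_of_nonneg hz32 (fun i => by positivity) (fun j => by positivity)).mul_left K
    refine Summable.of_norm_bounded this fun p => ?_
    rw [norm_mul, norm_pow, norm_neg, norm_one, one_pow, one_mul]
    refine (hD (p.2+1) (by omega) _).trans (le_of_eq ?_)
    ring
  have hsum3 : Summable (fun i : ℤ => ∑' j : ℕ, (-1:ℝ)^j * DD n (j+1) (n + 2 * i)) := hprod.prod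
  have hDs : ∀ j : ℕ, ∑' i : ℤ, (-1:ℝ)^j * DD n (j+1) (n + 2 * i) = (-1)^j * (A (j+1) - 2 * A (j+1+1) + A (j+1+2)) := by
    intro j
    rw [tsum_mul_left]
    congr 1
    unfold DD
    have s1 := (hS (j+1) (by omega)).hasSum
    have s2 := (hS (j+1+1) (by omega)).hasSum
    have s3 := (hS (j+1+2) (by omega)).hasSum
    exact ((s1.sub (s2.mul_left 2)).add s3).tsum_eq
  have hq : qAdm n = 3/4 * A 1 - 1/4 * A 2 + 1/4 * ∑' j : ℕ, (-1)^j * (A (j+1) - 2 * A (j+1+1) + A (j+1+2)) := by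
    rw [qAdm_eq_tsum n hn1]
    have s1 := (hS 1 le_rfl).hasSum
    have s2 := (hS 2 (by omega)).hasSum
    rw [(((s1.mul_left (3/4)).sub (s2.mul_left (1/4))).add (hsum3.hasSum.mul_left (1/4))).tsum_eq]
    have hcomm : ∑' i : ℤ, ∑' j : ℕ, (-1:ℝ)^j * DD n (j+1) (n + 2 * i) = ∑' j : ℕ, ∑' i : ℤ, (-1:ℝ)^j * DD n (j+1) (n + 2 * i) :=
      (Summable.tsum_comm hprod).symm
    rw [hcomm]
    simp only [hDs]
    rfl
  have hE : ‖∑' j : ℕ, (-1:ℝ)^j * (A (j+1) - 2 * A (j+1+1) + A (j+1+2))‖ ≤ 4 * C / (n:ℝ)^7 * ∑' j : ℕ, 1 / ((j+1:ℕ):ℝ)^2 := by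
    refine tsum_of_norm_bounded (hz.hasSum.mul_left _) fun j => ?_
    rw [norm_mul, norm_pow, norm_neg, norm_one, one_pow, one_mul, Real.norm_eq_abs]
    have m0 : ∀ k : ℕ, |A (j+1+k) - 2 * TT n| ≤ C / (n:ℝ)^7 * (1 / ((j+1:ℕ):ℝ)^2) := by
      intro k
      refine (hAj (j+1+k) (by omega)).trans ?_
      have hle : ((j+1:ℕ):ℝ) ≤ ((j+1+k:ℕ):ℝ) := by exact_mod_cast Nat.le_add_right _ _
      have hpos : (0:ℝ) < ((j+1:ℕ):ℝ) := by exact_mod_cast Nat.succ_pos j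
      exact mul_le_mul_of_nonneg_left (one_div_le_one_div_of_le (by positivity)
        (pow_le_pow_left₀ hpos.le hle 2)) (by positivity)
    have a1 := abs_le.mp (m0 0)
    have a2 := abs_le.mp (m0 1)
    have a3 := abs_le.mp (m0 2)
    rw [add_zero] at a1
    have : 4 * C / (n:ℝ)^7 * (1 / ((j+1:ℕ):ℝ)^2) = 4 * (C / (n:ℝ)^7 * (1 / ((j+1:ℕ):ℝ)^2)) := by ring
    rw [this, abs_le]
    constructor <;> linarith [a1.1, a1.2, a2.1, a2.2, a3.1, a3.2]
  rw [Real.norm_eq_abs] at hE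
  have hE' := abs_le.mp hE
  have c1 := hAj 1 le_rfl
  have c2 := hAj 2 (by omega)
  have c2' : C / (n:ℝ)^7 * (1 / ((2:ℕ):ℝ)^2) ≤ C / (n:ℝ)^7 := by
    have : 0 ≤ C / (n:ℝ)^7 := by positivity
    norm_num; linarith
  have d1 := abs_le.mp c1
  have d2 := abs_le.mp (c2.trans c2')
  norm_num at d1
  have e1 : (C + C * ∑' j : ℕ, 1 / ((j+1:ℕ):ℝ)^2) / (n:ℝ)^7 = C / (n:ℝ)^7 + 1/4 * (4 * C / (n:ℝ)^7 * ∑' j : ℕ, 1 / ((j+1:ℕ):ℝ)^2) := by ring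
  rw [e1, hq, abs_le]
  constructor <;> linarith [d1.1, d1.2, d2.1, d2.2, hE'.1, hE'.2]

end Aux

/-- Asymptotic expansion of the probability that a random walk on `ℤ` is admissible:
`q_n = 1/n − 4/(3n²) + 88/(45n³) − 976/(315n⁴) + 3488/(675n⁵) − 276928/(31185n⁶) + O(n^{−7})`. -/
theorem qAdm_asymptotics :
    ∃ C > (0 : ℝ), ∃ N₀ : ℕ, ∀ n : ℕ, N₀ ≤ n →
      |qAdm n -
          (1 / (n : ℝ) - 4 / (3 * (n : ℝ) ^ 2) + 88 / (45 * (n : ℝ) ^ 3) -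
            976 / (315 * (n : ℝ) ^ 4) + 3488 / (675 * (n : ℝ) ^ 5) -
            276928 / (31185 * (n : ℝ) ^ 6))| ≤
        C / (n : ℝ) ^ 7 := by
  obtain ⟨C1, h1, H1⟩ := qAdm_TT
  obtain ⟨C2, h2, H2⟩ := TT_asymp
  refine ⟨C1 + C2 + 1, by positivity, 13, fun n hn => ?_⟩
  have a1 := H1 n hn
  have a2 := H2 n (by omega)
  have hn0 : (0:ℝ) < n := by exact_mod_cast (by omega : 0 < n)
  refine (abs_sub_le _ (TT n) _).trans ((add_le_add a1 a2).trans ?_)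
  rw [← add_div]
  exact div_le_div_of_nonneg_right (by linarith) (by positivity)
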